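/- Let $k$ be an algebraically closed field of characteristic not $2$. A pivotal algebra over $k$ is a triple $(A, S, g)$ where $A$ is a unital associative $k$-algebra, $S : A \to A$ is a $k$-linear map with $S(xy) = S(y)S(x)$ and $S(1) = 1$, and $g \in A$ is an invertible element such that $S(g) = g^{-1}$ and $S^2(a) = g a g^{-1}$ for all $a \in A$. For a finite-dimensional left $A$-module $V$, let $\mathrm{Bil}_A(V)$ be the space of bilinear forms $b : V \times V \to k$ with $b(av, w) = b(v, S(a)w)$ for all $a \in A$ and $v, w \in V$; let $\Sigma_V$ be the endomorphism of $\mathrm{Bil}_A(V)$ given by $\Sigma_V(b)(v, w) = b(w, gv)$; let $\mathrm{Bil}_A^{\pm}(V)$ be its $\pm 1$-eigenspaces; let $\nu(V) = \dim_k \mathrm{Bil}_A^{+}(V) - \dim_k \mathrm{Bil}_A^{-}(V)$ be the Frobenius--Schur indicator of $V$; and let $\chi_V(a)$ be the trace of the action of $a \in A$ on $V$. Let $(A, S, g)$ be a finite-dimensional semisimple pivotal algebra over $k$, and let $V_1, \dots, V_n$ be a complete set of representatives of the isomorphism classes of simple left $A$-modules, with characters $\chi_i = \chi_{V_i}$.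 Then $$\mathrm{Trace}(S) = \sum_{i=1}^{n} \nu(V_i)\, \chi_i(g) \quad \text{in } k,$$ where $\mathrm{Trace}(S)$ is the trace of $S$ as a $k$-linear endomorphism of $A$. -/

import Mathlib

-- The value that Mathlib itself is compiled with.
set_option maxSynthPendingDepth 3

universe uk uA uV

/-- A pivotal algebra structure `(S, g)` on a unital associative `k`-algebra `A`: an anti-algebra
map `S : A → A` and an invertible element `g ∈ A` such that `S(g) = g⁻¹` and
`S²(a) = g a g⁻¹` for all `a ∈ A`. -/
structure PivotalAlgebra (k : Type*) (A : Type*) [Field k] [Ring A] [Algebra k A] where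
  S : A →ₗ[k] A
  S_mul : ∀ x y : A, S (x * y) = S y * S x
  S_one : S 1 = 1
  g : Aˣ
  S_g : S (g : A) = ((g⁻¹ : Aˣ) : A)
  S_S : ∀ a : A, S (S a) = (g : A) * a * ((g⁻¹ : Aˣ) : A)

/-- The trace of a linear involution in characteristic not 2. -/
theorem trace_of_involutive {k B : Type*} [Field k] [AddCommGroup B] [Module k B]
    [FiniteDimensional k B] (h2 : (2 : k) ≠ 0) (s : Module.End k B) (hs : ∀ b, s (s b) = b) :
    LinearMap.trace k B s = (Module.finrank k (Module.End.eigenspace s (1 : k)) : k)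
      - (Module.finrank k (Module.End.eigenspace s (-1 : k)) : k) := by
  have hp : LinearMap.IsProj (Module.End.eigenspace s (1 : k)) ((2 : k)⁻¹ • (1 + s)) := by
    constructor
    · intro b
      rw [Module.End.mem_eigenspace_iff]
      simp [hs, add_comm]
    · intro b hb
      rw [Module.End.mem_eigenspace_iff, one_smul] at hb
      simp only [LinearMap.smul_apply, LinearMap.add_apply, Module.End.one_apply, hb]
      rw [← two_smul k b, smul_smul, inv_mul_cancel₀ h2, one_smul]
  have hm : LinearMap.IsProj (Module.End.eigenspace s (-1 : k)) ((2 : k)⁻¹ • (1 - s)) := by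
    constructor
    · intro b
      rw [Module.End.mem_eigenspace_iff]
      simp [hs, ← smul_neg]
    · intro b hb
      rw [Module.End.mem_eigenspace_iff, neg_one_smul] at hb
      simp only [LinearMap.smul_apply, LinearMap.sub_apply, Module.End.one_apply, hb]
      rw [sub_neg_eq_add, ← two_smul k b, smul_smul, inv_mul_cancel₀ h2, one_smul]
  have e : s = (2 : k)⁻¹ • (1 + s) - (2 : k)⁻¹ • (1 - s) := by
    rw [← smul_sub, add_sub_sub_cancel, ← two_smul k s, smul_smul, inv_mul_cancel₀ h2, one_smul]
  rw [← hp.trace, ← hm.trace, ← map_sub, ← e]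

namespace PivotalAlgebra

section

variable {k A : Type*} [Field k] [Ring A] [Algebra k A] (P : PivotalAlgebra k A)
variable (V : Type*) [AddCommGroup V] [Module k V] [Module A V] [IsScalarTower k A V]

/-- `Bil_A(V)`: the space of bilinear forms `b` on the `A`-module `V` such that
`b(av, w) = b(v, S(a)w)` for all `a ∈ A` and `v, w ∈ V`. -/
def bilInv : Submodule k (LinearMap.BilinForm k V) where
  carrier := {b | ∀ (a : A) (v w : V), b (a • v) w = b v (P.S a • w)}
  add_mem' := by
    intro b c hb hc a v w
    simp [hb a v w, hc a v w]
  zero_mem' := by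
    intro a v w
    simp
  smul_mem' := by
    intro c b hb a v w
    simp [hb a v w]

/-- The map `Σ_V : Bil_A(V) → Bil_A(V)`, `Σ_V(b)(v, w) = b(w, g v)`. -/
def sigma : Module.End k (P.bilInv V) where
  toFun b :=
    ⟨(LinearMap.flip (b : LinearMap.BilinForm k V)) ∘ₗ Algebra.lsmul k k V (P.g : A), by
      intro a v w
      have h := b.2 (P.S a) w ((P.g : A) • v)
      rw [P.S_S, smul_smul] at h
      simpa [mul_assoc, smul_smul] using h.symm⟩
  map_add' b c := by
    ext v w
    simp
  map_smul' c b := by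
    ext v w
    simp

theorem sigma_apply (b : P.bilInv V) (v w : V) :
    (P.sigma V b : LinearMap.BilinForm k V) v w
      = (b : LinearMap.BilinForm k V) w ((P.g : A) • v) := rfl

/-- The Frobenius–Schur indicator `ν(V) = dim Bil_A⁺(V) − dim Bil_A⁻(V)`, where
`Bil_A^±(V)` are the `±1`-eigenspaces of `Σ_V`. -/
noncomputable def fsIndicator : ℤ :=
  (Module.finrank k (Module.End.eigenspace (P.sigma V) (1 : k)) : ℤ)
    - (Module.finrank k (Module.End.eigenspace (P.sigma V) (-1 : k)) : ℤ)

theorem sigma_sigma (b : P.bilInv V) : P.sigma V (P.sigma V b) = b := by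
  ext v w
  rw [sigma_apply, sigma_apply, b.2, P.S_g, smul_smul]
  simp

/-- In characteristic not 2, the image of `ν(V)` in `k` is the trace of `Σ_V`. -/
theorem fsIndicator_eq_trace (h2 : (2 : k) ≠ 0) [FiniteDimensional k V] :
    (P.fsIndicator V : k) = LinearMap.trace k (P.bilInv V) (P.sigma V) := by
  rw [trace_of_involutive h2 (P.sigma V) (P.sigma_sigma V)]
  simp [fsIndicator]

end

end PivotalAlgebra

/-- The character `χ_V(a) = Trace(a : V → V)` of an `A`-module `V`. -/
noncomputable def moduleCharacter (k : Type*) {A : Type*} [Field k] [Ring A] [Algebra k A]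
    (V : Type*) [AddCommGroup V] [Module k V] [Module A V] [IsScalarTower k A V] (a : A) : k :=
  LinearMap.trace k V (Algebra.lsmul k k V a)

open Module

section TraceLemmas

/-- The trace of `M ↦ C * Mᵀ * B` on square matrices is the trace of `C * Bᵀ`. -/
theorem trace_mul_transpose_mul {k m : Type*} [Field k] [Fintype m] [DecidableEq m]
    (T : End k (Matrix m m k)) (C B : Matrix m m k) (hT : ∀ M, T M = C * M.transpose * B) :
    LinearMap.trace k _ T = (C * B.transpose).trace := by
  rw [LinearMap.trace_eq_matrix_trace k (Matrix.stdBasis k m m), Matrix.trace,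
    Fintype.sum_prod_type, Matrix.trace]
  refine Finset.sum_congr rfl fun i _ => ?_
  rw [Matrix.diag_apply, Matrix.mul_apply]
  refine Finset.sum_congr rfl fun j _ => ?_
  rw [Matrix.diag_apply, LinearMap.toMatrix_apply, Matrix.stdBasis_eq_single, hT,
    Matrix.transpose_single]
  change (C * Matrix.single j i (1 : k) * B) i j = C i j * B i j
  simp [Matrix.mul_apply, Matrix.single_apply, ite_and]

/-- If `f a` is the right adjoint of `a` for a nondegenerate bilinear form `b` with
`b w (g v) = ε * b v w` and `ε * ε = 1`, then the trace of `f` on `End V` is `ε * Trace g`. -/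
theorem trace_adjoint_eq {k V : Type*} [Field k] [AddCommGroup V] [Module k V]
    [FiniteDimensional k V] (b : LinearMap.BilinForm k V) (hb : b.Nondegenerate)
    (f : End k (End k V)) (hf : ∀ a v w, b (a v) w = b v (f a w))
    (g : End k V) (ε : k) (hε : ε * ε = 1) (hg : ∀ v w, b w (g v) = ε * b v w) :
    LinearMap.trace k _ f = ε * LinearMap.trace k V g := by
  classical
  let e := finBasis k V
  let B := LinearMap.BilinForm.toMatrix e b
  have hB : IsUnit B.det := (LinearMap.BilinForm.nondegenerate_iff_det_ne_zero e).1 hb |>.isUnit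
  let φ := LinearMap.toMatrix e e
  have key : ∀ a, φ (f a) = B⁻¹ * (φ a).transpose * B := by
    intro a
    have h : (φ a).transpose * B = B * φ (f a) := by
      rw [← LinearMap.BilinForm.toMatrix_compLeft, ← LinearMap.BilinForm.toMatrix_compRight]
      congr 1
      ext v w
      exact hf a v w
    rw [mul_assoc, h, Matrix.nonsing_inv_mul_cancel_left _ _ hB]
  have hgB : φ g = ε • (B⁻¹ * B.transpose) := by
    have h : B * φ g = ε • B.transpose := by
      rw [← LinearMap.BilinForm.toMatrix_compRight]
      ext i j
      simp [B, LinearMap.BilinForm.toMatrix_apply, hg]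
    rw [← Matrix.mul_smul, ← h, Matrix.nonsing_inv_mul_cancel_left _ _ hB]
  rw [← LinearMap.trace_conj' f φ, trace_mul_transpose_mul (φ.conj f) B⁻¹ B,
    LinearMap.trace_eq_matrix_trace k e g]
  · change _ = ε * (φ g).trace
    rw [hgB, Matrix.trace_smul, smul_eq_mul, ← mul_assoc, hε, one_mul]
  · intro M
    rw [LinearEquiv.conj_apply_apply, key, LinearEquiv.apply_symm_apply]

end TraceLemmas

section Simple

variable {k A : Type*} [Field k] [Ring A] [Algebra k A]

theorem finiteDimensional_of_isSimpleModule [FiniteDimensional k A] (V : Type*) [AddCommGroup V]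
    [Module k V] [Module A V] [IsScalarTower k A V] [IsSimpleModule A V] :
    FiniteDimensional k V :=
  Module.Finite.trans A V

/-- The action of `A` on a family of modules, as an algebra map to the product of their
endomorphism algebras. -/
noncomputable def piAction (k A : Type*) [Field k] [Ring A] [Algebra k A] {ι : Type*}
    (V : ι → Type*) [∀ i, AddCommGroup (V i)]
    [∀ i, Module k (V i)] [∀ i, Module A (V i)] [∀ i, IsScalarTower k A (V i)] :
    A →ₐ[k] ∀ i, End k (V i) :=
  AlgHom.pi fun i => Algebra.lsmul k k (V i)

variable {ι : Type*} (V : ι → Type*) [∀ i, AddCommGroup (V i)]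
    [∀ i, Module k (V i)] [∀ i, Module A (V i)] [∀ i, IsScalarTower k A (V i)]

theorem piAction_apply (a : A) (i : ι) (v : V i) : piAction k A V a i v = a • v := rfl

/-- Endomorphisms of a finite product of pairwise non-isomorphic simple modules are diagonal. -/
theorem exists_scalars_of_end_pi [IsAlgClosed k] [FiniteDimensional k A] [Finite ι]
    (hsimple : ∀ i, IsSimpleModule A (V i))
    (hdistinct : ∀ i j, i ≠ j → IsEmpty (V i ≃ₗ[A] V j)) (φ : End A (∀ i, V i)) :
    ∃ c : ι → k, ∀ m i, φ m i = c i • m i := by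
  classical
  have := Fintype.ofFinite ι
  have hfd := fun i => finiteDimensional_of_isSimpleModule (k := k) (A := A) (V i)
  have hS : ∀ i, ∃ c : k, ∀ v : V i, φ (Pi.single i v) i = c • v := by
    intro i
    obtain ⟨c, hc⟩ := (IsSimpleModule.algebraMap_end_bijective_of_isAlgClosed k).2
      (LinearMap.proj i ∘ₗ φ ∘ₗ LinearMap.single A V i)
    exact ⟨c, fun v => (LinearMap.congr_fun hc v).symm⟩
  have h0 : ∀ i j, j ≠ i → ∀ v : V j, φ (Pi.single j v) i = 0 := by
    intro i j hij v
    rcases LinearMap.bijective_or_eq_zero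
      (LinearMap.proj i ∘ₗ φ ∘ₗ LinearMap.single A V j) with h | h
    · exact ((hdistinct j i hij).false (LinearEquiv.ofBijective _ h)).elim
    · exact LinearMap.congr_fun h v
  choose c hc using hS
  refine ⟨c, fun m i => ?_⟩
  conv_lhs => rw [← Finset.univ_sum_single m]
  rw [map_sum, Finset.sum_apply, Finset.sum_eq_single i (fun j _ hj => h0 i j hj _) (by simp), hc]

theorem piAction_surjective [IsAlgClosed k] [FiniteDimensional k A] [Finite ι]
    (hsimple : ∀ i, IsSimpleModule A (V i))
    (hdistinct : ∀ i j, i ≠ j → IsEmpty (V i ≃ₗ[A] V j)) :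
    Function.Surjective (piAction k A V) := by
  classical
  intro x
  have hfd := fun i => finiteDimensional_of_isSimpleModule (k := k) (A := A) (V i)
  let F : End (End A (∀ i, V i)) (∀ i, V i) :=
    { toFun := fun m i => x i (m i)
      map_add' := fun m m' => by ext i; simp
      map_smul' := fun φ m => by
        obtain ⟨c, hc⟩ := exists_scalars_of_end_pi (k := k) V hsimple hdistinct φ
        ext i
        simp [End.smul_def, hc] }
  obtain ⟨s, hs⟩ := Module.Finite.fg_top (R := k) (M := ∀ i, V i)
  obtain ⟨a, ha⟩ := jacobson_density F s
  have h : ∀ m : ∀ i, V i, F m = a • m := by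
    intro m
    induction hs.ge (trivial : m ∈ ⊤) using Submodule.span_induction with
    | mem m hm => exact ha m hm
    | zero => simp
    | add _ _ _ _ h₁ h₂ => rw [map_add, h₁, h₂, smul_add]
    | smul c m _ h =>
      rw [smul_comm a c m, ← h]
      ext i
      exact map_smul (x i) c (m i)
  refine ⟨a, ?_⟩
  ext i v
  have := congrFun (h (Pi.single i v)) i
  simpa [F, piAction_apply] using this.symm

theorem piAction_injective {A : Type uA} [Ring A] [Algebra k A] [IsSemisimpleRing A]
    [∀ i, Module A (V i)] [∀ i, IsScalarTower k A (V i)]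
    (hcomplete : ∀ (M : Type uA) [AddCommGroup M] [Module A M], IsSimpleModule A M →
      ∃ i, Nonempty (M ≃ₗ[A] V i)) :
    Function.Injective (piAction k A V) := by
  rw [injective_iff_map_eq_zero]
  intro a ha
  have hmem : a ∈ Ring.jacobson A := by
    refine Ideal.mem_sInf.mpr fun {I} hI => ?_
    obtain ⟨i, ⟨e⟩⟩ := hcomplete (A ⧸ I) (isSimpleModule_iff_isCoatom.mpr hI)
    have h : e (a • Submodule.Quotient.mk 1) = 0 := by
      rw [map_smul, ← piAction_apply (k := k) V, ha]
      rfl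
    rw [e.map_eq_zero_iff, ← Submodule.Quotient.mk_smul, Submodule.Quotient.mk_eq_zero] at h
    simpa using h
  rwa [IsSemisimpleRing.jacobson_eq_bot] at hmem

end Simple

namespace PivotalAlgebra

variable {k A : Type*} [Field k] [Ring A] [Algebra k A] (P : PivotalAlgebra k A)

theorem S_surjective : Function.Surjective P.S := fun a =>
  ⟨P.S (((P.g⁻¹ : Aˣ) : A) * a * (P.g : A)), by rw [P.S_S]; simp [mul_assoc]⟩

variable {V : Type*} [AddCommGroup V] [Module k V] [Module A V]

theorem bilInv_separatingLeft [IsSimpleModule A V] {b : LinearMap.BilinForm k V}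
    (hb : b ∈ P.bilInv V) (h0 : b ≠ 0) : b.SeparatingLeft := by
  let K : Submodule A V :=
    { carrier := {v | ∀ w, b v w = 0}
      add_mem' := fun {v v'} hv hv' w => by simp [hv w, hv' w]
      zero_mem' := fun w => by simp
      smul_mem' := fun a v hv w => by rw [hb a v w]; exact hv _ }
  rcases eq_bot_or_eq_top K with h | h
  · intro v hv
    exact (Submodule.mem_bot A).1 (h ▸ (show v ∈ K from hv))
  · refine (h0 ?_).elim
    ext v w
    exact (show v ∈ K from h ▸ Submodule.mem_top) w

theorem bilInv_nondegenerate [IsSimpleModule A V] {b : LinearMap.BilinForm k V}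
    (hb : b ∈ P.bilInv V) (h0 : b ≠ 0) : b.Nondegenerate := by
  refine ⟨P.bilInv_separatingLeft hb h0, ?_⟩
  let K : Submodule A V :=
    { carrier := {w | ∀ v, b v w = 0}
      add_mem' := fun {v v'} hv hv' w => by simp [hv w, hv' w]
      zero_mem' := fun w => by simp
      smul_mem' := fun a v hv w => by
        obtain ⟨a, rfl⟩ := P.S_surjective a
        rw [← hb a w v]; exact hv _ }
  rcases eq_bot_or_eq_top K with h | h
  · intro v hv
    exact (Submodule.mem_bot A).1 (h ▸ (show v ∈ K from hv))
  · refine (h0 ?_).elim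
    ext v w
    exact (show w ∈ K from h ▸ Submodule.mem_top) v

variable [IsScalarTower k A V]

/-- Invariant forms on a simple module are proportional to any nonzero one. -/
theorem exists_smul_eq_of_mem_bilInv [IsAlgClosed k] [FiniteDimensional k V] [IsSimpleModule A V]
    {b b' : LinearMap.BilinForm k V} (hb : b ∈ P.bilInv V) (h0 : b ≠ 0) (hb' : b' ∈ P.bilInv V) :
    ∃ c : k, b' = c • b := by
  have hnd := P.bilInv_separatingLeft hb h0
  have hinj : Function.Injective b := by
    rw [injective_iff_map_eq_zero]
    exact fun v hv => hnd v fun w => by rw [hv, LinearMap.zero_apply]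
  have hsurj : Function.Surjective b :=
    (LinearMap.injective_iff_surjective_of_finrank_eq_finrank
      (Subspace.dual_finrank_eq (K := k) (V := V)).symm).1 hinj
  choose h hh using fun v => hsurj (b' v)
  let φ : End A V :=
    { toFun := h
      map_add' := fun v w => hinj (by simp [hh])
      map_smul' := fun a v => hinj (by
        ext w
        rw [hh, hb' a v w, RingHom.id_apply, hb a (h v) w, hh]) }
  obtain ⟨c, hc⟩ := (IsSimpleModule.algebraMap_end_bijective_of_isAlgClosed k).2 φ
  refine ⟨c, ?_⟩
  ext v w
  have h1 : h v = c • v := (LinearMap.congr_fun hc v).symm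
  rw [← hh, h1]
  simp

/-- If a module has no nonzero invariant form, the corresponding diagonal block of `S`
vanishes. -/
theorem block_eq_zero [FiniteDimensional k V] (hbot : P.bilInv V = ⊥) (s : End k V →ₗ[k] A)
    (hmul : ∀ (a : A) (x : End k V), s (Algebra.lsmul k k V a * x) = a * s x) :
    (Algebra.lsmul k k V).toLinearMap ∘ₗ P.S ∘ₗ s = 0 := by
  set f : End k (End k V) := (Algebra.lsmul k k V).toLinearMap ∘ₗ P.S ∘ₗ s with hf
  have hrank : ∀ (φ : Dual k V) (v : V), f (φ.smulRight v) = 0 := by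
    intro φ v
    ext w
    rw [LinearMap.zero_apply, ← Module.forall_dual_apply_eq_zero_iff k]
    intro ψ
    let b : LinearMap.BilinForm k V := LinearMap.mk₂ k (fun v w => ψ (f (φ.smulRight v) w))
      (fun v v' w => by
        rw [show φ.smulRight (v + v') = φ.smulRight v + φ.smulRight v' by ext; simp]; simp)
      (fun c v w => by
        rw [show φ.smulRight (c • v) = c • φ.smulRight v by
          ext; exact smul_comm ..]
        simp)
      (fun v w w' => by simp) (fun c v w => by simp)
    have hb : b ∈ P.bilInv V := by
      intro a v w
      have h1 : φ.smulRight (a • v) = Algebra.lsmul k k V a * φ.smulRight v := by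
        ext x
        exact (LinearMap.map_smul (Algebra.lsmul k k V a) (φ x) v).symm
      change ψ (f (φ.smulRight (a • v)) w) = ψ (f (φ.smulRight v) (P.S a • w))
      rw [h1]
      simp [hf, hmul, P.S_mul]
    rw [hbot, Submodule.mem_bot] at hb
    exact LinearMap.congr_fun₂ hb v w
  ext1 x
  obtain ⟨t, rfl⟩ := (dualTensorHomEquiv k V V).surjective x
  induction t with
  | zero => simp
  | add t u ht hu => rw [map_add, map_add, ht, hu]; simp
  | tmul φ v =>
    rw [LinearMap.zero_apply, ← hrank φ v]
    congr 1

theorem trace_block [IsAlgClosed k] (h2 : (2 : k) ≠ 0) [FiniteDimensional k V] [IsSimpleModule A V]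
    (s : End k V →ₗ[k] A)
    (hmul : ∀ (a : A) (x : End k V), s (Algebra.lsmul k k V a * x) = a * s x)
    (hs : ∀ x : End k V, Algebra.lsmul k k V (s x) = x) :
    LinearMap.trace k _ ((Algebra.lsmul k k V).toLinearMap ∘ₗ P.S ∘ₗ s) =
      (P.fsIndicator V : k) * moduleCharacter k V (P.g : A) := by
  rw [P.fsIndicator_eq_trace V h2]
  by_cases hbot : P.bilInv V = ⊥
  · have : Subsingleton (P.bilInv V) := by rw [hbot]; infer_instance
    rw [P.block_eq_zero hbot s hmul, map_zero, Subsingleton.elim (P.sigma V) 0, map_zero, zero_mul]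
  · obtain ⟨b, hb, h0⟩ := (Submodule.ne_bot_iff _).1 hbot
    obtain ⟨ε, hε⟩ := P.exists_smul_eq_of_mem_bilInv hb h0 (P.sigma V ⟨b, hb⟩).2
    have hsp : ∀ b' : P.bilInv V, ∃ c : k, c • (⟨b, hb⟩ : P.bilInv V) = b' := fun b' => by
      obtain ⟨c, hc⟩ := P.exists_smul_eq_of_mem_bilInv hb h0 b'.2
      exact ⟨c, Subtype.ext hc.symm⟩
    have hdim : finrank k (P.bilInv V) = 1 :=
      finrank_eq_one (⟨b, hb⟩ : P.bilInv V) (fun h => h0 (congrArg Subtype.val h)) hsp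
    have hσ : P.sigma V = ε • LinearMap.id := by
      ext1 b'
      obtain ⟨c, rfl⟩ := hsp b'
      rw [map_smul, show P.sigma V ⟨b, hb⟩ = ε • ⟨b, hb⟩ from Subtype.ext hε, smul_comm]
      rfl
    have hε2 : ε * ε = 1 := by
      have h := P.sigma_sigma V ⟨b, hb⟩
      rw [hσ] at h
      have h' : (ε * ε) • b = (1 : k) • b := by
        rw [one_smul, mul_smul]
        exact congrArg Subtype.val h
      exact smul_left_injective k h0 h'
    rw [hσ, map_smul, LinearMap.trace_id, hdim, Nat.cast_one, smul_eq_mul, mul_one]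
    refine trace_adjoint_eq b (P.bilInv_nondegenerate hb h0) _ (fun a v w => ?_) _ ε hε2
      fun v w => ?_
    · conv_lhs => rw [← hs a]
      exact hb (s a) v w
    · exact LinearMap.congr_fun₂ hε v w

end PivotalAlgebra

theorem trace_antipode_eq_sum
    {k : Type uk} {A : Type uA} [Field k] [IsAlgClosed k] [Ring A] [Algebra k A]
    (hchar : ringChar k ≠ 2)
    [FiniteDimensional k A] [IsSemisimpleRing A]
    (P : PivotalAlgebra k A)
    (n : ℕ) (V : Fin n → Type uV)
    [∀ i, AddCommGroup (V i)] [∀ i, Module k (V i)] [∀ i, Module A (V i)]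
    [∀ i, IsScalarTower k A (V i)]
    (hsimple : ∀ i, IsSimpleModule A (V i))
    (hdistinct : ∀ i j, i ≠ j → IsEmpty (V i ≃ₗ[A] V j))
    -- Every simple `A`-module is isomorphic to a quotient of `A` by a maximal left ideal, so it
    -- suffices to let `M` range over the universe of `A`; the `V i` may live in any universe.
    (hcomplete : ∀ (M : Type uA) [AddCommGroup M] [Module A M], IsSimpleModule A M →
      ∃ i, Nonempty (M ≃ₗ[A] V i)) :
    LinearMap.trace k A P.S =
      ∑ i : Fin n, (P.fsIndicator (V i) : k) * moduleCharacter k (V i) (P.g : A) := by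
  classical
  have h2 : (2 : k) ≠ 0 := Ring.two_ne_zero hchar
  have hfd := fun i => finiteDimensional_of_isSimpleModule (k := k) (A := A) (V i)
  let e : A ≃ₐ[k] ∀ i, Module.End k (V i) := AlgEquiv.ofBijective (piAction k A V)
    ⟨piAction_injective V hcomplete, piAction_surjective V hsimple hdistinct⟩
  let s (i : Fin n) : Module.End k (V i) →ₗ[k] A :=
    e.symm.toLinearMap ∘ₗ LinearMap.single k (fun i => Module.End k (V i)) i
  have he : ∀ a i, e a i = Algebra.lsmul k k (V i) a := fun _ _ => rfl
  have hes : ∀ i x, e (s i x) = Pi.single i x := fun i x => e.apply_symm_apply _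
  have hid : P.S = ∑ i, (P.S ∘ₗ s i) ∘ₗ (Algebra.lsmul k k (V i)).toLinearMap := by
    ext a
    have ha : a = ∑ i, s i (Algebra.lsmul k k (V i) a) := by
      apply e.injective
      rw [map_sum]
      simp_rw [hes, ← he]
      exact (Finset.univ_sum_single (e a)).symm
    conv_lhs => rw [ha, map_sum]
    simp
  rw [hid, map_sum]
  refine Finset.sum_congr rfl fun i _ => ?_
  rw [LinearMap.trace_comp_comm']
  refine P.trace_block h2 (s i) (fun a x => ?_) fun x => ?_
  · apply e.injective
    rw [map_mul e, hes, hes]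
    ext1 j
    rw [Pi.mul_apply, he]
    rcases eq_or_ne j i with rfl | h
    · simp
    · simp [h]
  · rw [← he, hes, Pi.single_eq_same]
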